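/- For every integer n ≥ 1 and every α ∈ (0,1) there exist constants ε > 0 and C_M > 0 with the following property. Let J : ℝ^{2n} → End(ℝ^{2n}) be α-Hölder with J(x) ∘ J(x) = −id for all x and ‖J − J_st‖_{C^α(ℝ^{2n})} < ε. Let r ∈ (0,1], x₀ ∈ ℝ^{2n}, and let u : D̄ → ℝ^{2n} be continuous, differentiable on the open unit disk D with ∂u/∂x + J(u) ∂u/∂y = 0, with u(0) = x₀ and |u(z) − x₀| ≥ r for all z ∈ ∂D. Then ∫_{u^{-1}(B(x₀,r))} ‖du‖² dA ≥ C_M r², where B(x₀,r) = {p ∈ ℝ^{2n} : |p − x₀| < r}. (Local chart version of the monotonicity lemma, Lemma 2.6 part 1.) -/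

import Mathlib

open MeasureTheory

/-- The standard complex structure `J_st` on `ℝ^{2n} ≅ ℂ^n`, i.e. multiplication
by `i`. -/
noncomputable def Jstd (n : ℕ) : (Fin n → ℂ) →L[ℝ] (Fin n → ℂ) :=
  Complex.I • (ContinuousLinearMap.id ℝ (Fin n → ℂ))

section Fourier
open scoped FourierTransform ContDiff

variable {V : Type*} [NormedAddCommGroup V] [InnerProductSpace ℝ V] [FiniteDimensional ℝ V]
  [MeasurableSpace V] [BorelSpace V]

/-- On `L¹ ∩ L²` the `L²` Fourier transform is given by the Fourier integral. -/
theorem fourier_toLp_ae_eq {f : V → ℂ} (hf : Integrable f) (hf2 : MemLp f 2) :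
    (𝓕 (hf2.toLp f) : Lp ℂ 2 (volume : Measure V)) =ᵐ[volume] 𝓕 f := by
  have hcont : Continuous (𝓕 f) :=
    VectorFourier.fourierIntegral_continuous Real.continuous_fourierChar
      (L := innerₗ V) continuous_inner hf
  apply ae_eq_of_integral_contDiff_smul_eq
  · exact (Lp.memLp _).locallyIntegrable (by norm_num)
  · exact hcont.locallyIntegrable
  · intro g hg hgc
    have hg₁ : HasCompactSupport (Complex.ofRealCLM ∘ g) := hgc.comp_left rfl
    have hg₂ : ContDiff ℝ ∞ (Complex.ofRealCLM ∘ g) := by fun_prop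
    have h := congrArg (fun T ↦ T (hg₁.toSchwartzMap hg₂))
      (Lp.fourier_toTemperedDistribution_eq (hf2.toLp f))
    simp only [TemperedDistribution.fourier_apply, Lp.toTemperedDistribution_apply] at h
    calc ∫ x, g x • (𝓕 (hf2.toLp f) : Lp ℂ 2 (volume : Measure V)) x
        = ∫ x, (hg₁.toSchwartzMap hg₂) x • (𝓕 (hf2.toLp f) : Lp ℂ 2 (volume : Measure V)) x := by
          simp
      _ = ∫ x, 𝓕 (hg₁.toSchwartzMap hg₂) x • (hf2.toLp f) x := h.symm
      _ = ∫ x, 𝓕 (⇑(hg₁.toSchwartzMap hg₂)) x • f x := by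
          apply integral_congr_ae
          filter_upwards [hf2.coeFn_toLp] with x hx
          rw [hx, SchwartzMap.fourier_coe]
      _ = ∫ x, (hg₁.toSchwartzMap hg₂) x • 𝓕 f x := by
          simpa using! (VectorFourier.integral_fourierIntegral_smul_eq_flip (L := innerₗ V)
            Real.continuous_fourierChar continuous_inner
            (hg₁.toSchwartzMap hg₂).integrable hf)
      _ = ∫ x, g x • 𝓕 f x := by simp

/-- Plancherel's identity on `L¹ ∩ L²`. -/
theorem integral_conj_fourier_mul_fourier {f g : V → ℂ} (hf : Integrable f) (hf2 : MemLp f 2)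
    (hg : Integrable g) (hg2 : MemLp g 2) :
    ∫ x, starRingEnd ℂ (𝓕 f x) * 𝓕 g x = ∫ x, starRingEnd ℂ (f x) * g x := by
  have h := Lp.inner_fourier_eq (hf2.toLp f) (hg2.toLp g)
  rw [L2.inner_def, L2.inner_def] at h
  calc _ = ∫ x, inner ℂ ((𝓕 (hf2.toLp f) : Lp ℂ 2 (volume : Measure V)) x)
        ((𝓕 (hg2.toLp g) : Lp ℂ 2 (volume : Measure V)) x) := by
        apply integral_congr_ae
        filter_upwards [fourier_toLp_ae_eq hf hf2, fourier_toLp_ae_eq hg hg2] with x h1 h2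
        rw [h1, h2, RCLike.inner_apply, mul_comm]
    _ = _ := h
    _ = _ := by
        apply integral_congr_ae
        filter_upwards [hf2.coeFn_toLp, hg2.coeFn_toLp] with x h1 h2
        rw [h1, h2, RCLike.inner_apply, mul_comm]

theorem integral_fderiv_mul_fderiv_comm_complex {f g : V → ℂ}
    (hf : Integrable f) (df : Differentiable ℝ f) (hf1 : Integrable (fderiv ℝ f))
    (hf2 : MemLp (fderiv ℝ f) 2)
    (hg : Integrable g) (dg : Differentiable ℝ g) (hg1 : Integrable (fderiv ℝ g))
    (hg2 : MemLp (fderiv ℝ g) 2) (v w : V) :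
    ∫ x, starRingEnd ℂ (fderiv ℝ f x v) * fderiv ℝ g x w =
      ∫ x, starRingEnd ℂ (fderiv ℝ f x w) * fderiv ℝ g x v := by
  have key : ∀ {f : V → ℂ}, Integrable f → Differentiable ℝ f → Integrable (fderiv ℝ f) →
      ∀ v ξ, 𝓕 (fun x ↦ fderiv ℝ f x v) ξ =
        (2 * Real.pi * Complex.I) * (inner ℝ ξ v : ℝ) * 𝓕 f ξ := by
    intro f hf df hf1 v ξ
    rw [← Real.fourier_continuousLinearMap_apply hf1, Real.fourier_fderiv hf df hf1]
    rw [VectorFourier.fourierSMulRight_apply]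
    change -(2 * Real.pi * Complex.I) • ((-(inner ℝ ξ v) : ℝ) • 𝓕 f ξ) = _
    rw [smul_eq_mul, Complex.real_smul]
    push_cast
    ring
  have i1 {f : V → ℂ} (h : Integrable (fderiv ℝ f)) (v : V) :
      Integrable (fun x ↦ fderiv ℝ f x v) := h.apply_continuousLinearMap v
  have i2 {f : V → ℂ} (h : MemLp (fderiv ℝ f) 2) (v : V) :
      MemLp (fun x ↦ fderiv ℝ f x v) 2 :=
    (ContinuousLinearMap.apply ℝ ℂ v).comp_memLp' h
  rw [← integral_conj_fourier_mul_fourier (i1 hf1 v) (i2 hf2 v) (i1 hg1 w) (i2 hg2 w),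
    ← integral_conj_fourier_mul_fourier (i1 hf1 w) (i2 hf2 w) (i1 hg1 v) (i2 hg2 v)]
  congr 1 with ξ
  rw [key hf df hf1, key hf df hf1, key hg dg hg1, key hg dg hg1]
  simp only [map_mul, Complex.conj_ofReal]
  ring

theorem integral_fderiv_mul_fderiv_comm_real {f g : V → ℝ}
    (hf : Integrable f) (df : Differentiable ℝ f) (hf1 : Integrable (fderiv ℝ f))
    (hf2 : MemLp (fderiv ℝ f) 2)
    (hg : Integrable g) (dg : Differentiable ℝ g) (hg1 : Integrable (fderiv ℝ g))
    (hg2 : MemLp (fderiv ℝ g) 2) (v w : V) :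
    ∫ x, fderiv ℝ f x v * fderiv ℝ g x w = ∫ x, fderiv ℝ f x w * fderiv ℝ g x v := by
  have hd {f : V → ℝ} (df : Differentiable ℝ f) :
      fderiv ℝ (fun x ↦ (f x : ℂ)) = fun x ↦ Complex.ofRealCLM.comp (fderiv ℝ f x) := by
    ext1 x
    exact (Complex.ofRealCLM.hasFDerivAt.comp x (df x).hasFDerivAt).fderiv
  have h1 {f : V → ℝ} (df : Differentiable ℝ f) (h : Integrable (fderiv ℝ f)) :
      Integrable (fderiv ℝ (fun x ↦ (f x : ℂ))) := by
    rw [hd df]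
    exact (ContinuousLinearMap.compL ℝ V ℝ ℂ Complex.ofRealCLM).integrable_comp h
  have h2 {f : V → ℝ} (df : Differentiable ℝ f) (h : MemLp (fderiv ℝ f) 2) :
      MemLp (fderiv ℝ (fun x ↦ (f x : ℂ))) 2 := by
    rw [hd df]
    exact (ContinuousLinearMap.compL ℝ V ℝ ℂ Complex.ofRealCLM).comp_memLp' h
  have h := integral_fderiv_mul_fderiv_comm_complex (Complex.ofRealCLM.integrable_comp hf)
    (Complex.ofRealCLM.differentiable.comp df) (h1 df hf1) (h2 df hf2)
    (Complex.ofRealCLM.integrable_comp hg)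
    (Complex.ofRealCLM.differentiable.comp dg) (h1 dg hg1) (h2 dg hg2) v w
  simp only [Complex.ofRealCLM_apply, hd df, hd dg] at h
  simp only [ContinuousLinearMap.comp_apply, Complex.ofRealCLM_apply, Complex.conj_ofReal,
    ← Complex.ofReal_mul, integral_complex_ofReal] at h
  exact_mod_cast h

theorem integral_inner_fderiv_comm {H : Type*} [NormedAddCommGroup H] [InnerProductSpace ℝ H]
    [FiniteDimensional ℝ H] (S : H →L[ℝ] H) {f g : V → H}
    (hf : Integrable f) (df : Differentiable ℝ f) (hf1 : Integrable (fderiv ℝ f))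
    (hf2 : MemLp (fderiv ℝ f) 2)
    (hg : Integrable g) (dg : Differentiable ℝ g) (hg1 : Integrable (fderiv ℝ g))
    (hg2 : MemLp (fderiv ℝ g) 2) (v w : V) :
    Integrable (fun x ↦ inner ℝ (S (fderiv ℝ f x v)) (fderiv ℝ g x w)) ∧
    ∫ x, inner ℝ (S (fderiv ℝ f x v)) (fderiv ℝ g x w) =
      ∫ x, inner ℝ (S (fderiv ℝ f x w)) (fderiv ℝ g x v) := by
  let b := stdOrthonormalBasis ℝ H
  have hd (L : H →L[ℝ] ℝ) {f : V → H} (df : Differentiable ℝ f) :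
      fderiv ℝ (fun x ↦ L (f x)) = fun x ↦ L.comp (fderiv ℝ f x) := by
    ext1 x
    exact (L.hasFDerivAt.comp x (df x).hasFDerivAt).fderiv
  have h1 (L : H →L[ℝ] ℝ) {f : V → H} (df : Differentiable ℝ f) (h : Integrable (fderiv ℝ f)) :
      Integrable (fderiv ℝ (fun x ↦ L (f x))) := by
    rw [hd L df]
    exact (ContinuousLinearMap.compL ℝ V H ℝ L).integrable_comp h
  have h2 (L : H →L[ℝ] ℝ) {f : V → H} (df : Differentiable ℝ f) (h : MemLp (fderiv ℝ f) 2) :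
      MemLp (fderiv ℝ (fun x ↦ L (f x))) 2 := by
    rw [hd L df]
    exact (ContinuousLinearMap.compL ℝ V H ℝ L).comp_memLp' h
  have hsc (L M : H →L[ℝ] ℝ) := integral_fderiv_mul_fderiv_comm_real (L.integrable_comp hf)
    (L.differentiable.comp df) (h1 L df hf1) (h2 L df hf2) (M.integrable_comp hg)
    (M.differentiable.comp dg) (h1 M dg hg1) (h2 M dg hg2) v w
  have hexp (x y : H) : inner ℝ x y = ∑ i, innerSL ℝ (b i) x * innerSL ℝ (b i) y := by
    rw [← b.sum_inner_mul_inner]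
    simp [real_inner_comm]
  have hi (i) (v w : V) : Integrable (fun x ↦ innerSL ℝ (b i) (S (fderiv ℝ f x v)) *
      innerSL ℝ (b i) (fderiv ℝ g x w)) :=
    MemLp.integrable_mul
      (((innerSL ℝ (b i)).comp (S.comp (ContinuousLinearMap.apply ℝ H v))).comp_memLp' hf2)
      (((innerSL ℝ (b i)).comp (ContinuousLinearMap.apply ℝ H w)).comp_memLp' hg2)
  simp_rw [hexp]
  refine ⟨integrable_finsetSum _ fun i _ ↦ hi i v w, ?_⟩
  rw [integral_finsetSum _ fun i _ ↦ hi i v w, integral_finsetSum _ fun i _ ↦ hi i w v]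
  refine Finset.sum_congr rfl fun i _ ↦ ?_
  have := hsc ((innerSL ℝ (b i)).comp S) (innerSL ℝ (b i))
  rwa [hd _ df, hd _ dg] at this

end Fourier

section Cutoff
open Metric Set Filter Topology

/-- The part of the unit disk mapped by `W` into the open ball of squared radius `s`. -/
def sublevel {E : Type*} [NormedAddCommGroup E] (W : ℂ → E) (s : ℝ) : Set ℂ :=
  ball 0 1 ∩ {z | ‖W z‖ ^ 2 < s}

theorem sublevel_subset {E : Type*} [NormedAddCommGroup E] (W : ℂ → E) {s t : ℝ} (h : s ≤ t) :
    sublevel W s ⊆ sublevel W t :=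
  inter_subset_inter_right _ fun _ hz ↦ lt_of_lt_of_le hz h

theorem isOpen_sublevel {E : Type*} [NormedAddCommGroup E] {W : ℂ → E}
    (hW : ContinuousOn W (ball 0 1)) (s : ℝ) : IsOpen (sublevel W s) :=
  (hW.norm.pow 2).isOpen_inter_preimage isOpen_ball (isOpen_Iio (a := s))

variable {H : Type*} [NormedAddCommGroup H] [InnerProductSpace ℝ H]

/-- The energy density of a map from the plane. -/
noncomputable def energyDensity (W : ℂ → H) (z : ℂ) : ℝ :=
  ‖fderiv ℝ W z 1‖ ^ 2 + ‖fderiv ℝ W z Complex.I‖ ^ 2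

/-- The map `φ(|W|²) W` on the unit disk, extended by zero. -/
noncomputable def cutoff (φ : ℝ → ℝ) (W : ℂ → H) : ℂ → H :=
  (ball 0 1).indicator fun z ↦ φ (‖W z‖ ^ 2) • W z

theorem energyDensity_nonneg (W : ℂ → H) (z : ℂ) : 0 ≤ energyDensity W z := by
  unfold energyDensity; positivity

theorem sq_norm_fderiv_le_energyDensity (W : ℂ → H) (z : ℂ) :
    ‖fderiv ℝ W z‖ ^ 2 ≤ 2 * energyDensity W z := by
  have h : ‖fderiv ℝ W z‖ ≤ ‖fderiv ℝ W z 1‖ + ‖fderiv ℝ W z Complex.I‖ := by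
    refine ContinuousLinearMap.opNorm_le_bound _ (by positivity) fun v ↦ ?_
    have hv : v = v.re • (1 : ℂ) + v.im • Complex.I := by
      simp [Complex.re_add_im]
    calc ‖fderiv ℝ W z v‖ = ‖v.re • fderiv ℝ W z 1 + v.im • fderiv ℝ W z Complex.I‖ := by
          conv_lhs => rw [hv, map_add, map_smul, map_smul]
      _ ≤ |v.re| * ‖fderiv ℝ W z 1‖ + |v.im| * ‖fderiv ℝ W z Complex.I‖ := by
          refine (norm_add_le _ _).trans ?_
          simp [norm_smul]
      _ ≤ ‖v‖ * ‖fderiv ℝ W z 1‖ + ‖v‖ * ‖fderiv ℝ W z Complex.I‖ := by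
          gcongr
          · exact Complex.abs_re_le_norm v
          · exact Complex.abs_im_le_norm v
      _ = _ := by ring
  unfold energyDensity
  have h0 := norm_nonneg (fderiv ℝ W z)
  nlinarith [sq_nonneg (‖fderiv ℝ W z 1‖ - ‖fderiv ℝ W z Complex.I‖)]

theorem measurable_energyDensity [CompleteSpace H] (W : ℂ → H) :
    Measurable (energyDensity W) := by
  borelize H
  unfold energyDensity
  have h (v : ℂ) : Measurable fun z ↦ fderiv ℝ W z v := measurable_fderiv_apply_const ℝ W v
  exact ((h 1).norm.pow_const 2).add ((h _).norm.pow_const 2)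

theorem hasFDerivAt_cutoff {φ : ℝ → ℝ} {φ' : ℝ} {W : ℂ → H} {z : ℂ} (hz : z ∈ ball (0 : ℂ) 1)
    (hW : DifferentiableAt ℝ W z) (hφ : HasDerivAt φ φ' (‖W z‖ ^ 2)) :
    HasFDerivAt (cutoff φ W) (φ (‖W z‖ ^ 2) • fderiv ℝ W z +
      (φ' • (2 • (innerSL ℝ (W z)).comp (fderiv ℝ W z))).smulRight (W z)) z := by
  have h1 := (hφ.comp_hasFDerivAt z hW.hasFDerivAt.norm_sq).smul hW.hasFDerivAt
  refine h1.congr_of_eventuallyEq ?_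
  filter_upwards [isOpen_ball.mem_nhds hz] with y hy
  simp [cutoff, hy]

variable {φ φ' : ℝ → ℝ} {R : ℝ} {W : ℂ → H}

theorem cutoff_eventuallyEq_zero (hW : ContinuousOn W (closedBall 0 1))
    (hb : ∀ z : ℂ, ‖z‖ = 1 → R < ‖W z‖ ^ 2) (hφ0 : ∀ s, R ≤ s → φ s = 0) {z : ℂ}
    (hz : z ∉ ball (0 : ℂ) 1) : cutoff φ W =ᶠ[𝓝 z] 0 := by
  have hK : IsClosed (closedBall (0 : ℂ) 1 ∩ (fun z ↦ ‖W z‖ ^ 2) ⁻¹' Iic R) :=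
    (hW.norm.pow 2).preimage_isClosed_of_isClosed isClosed_closedBall isClosed_Iic
  have hzK : z ∈ (closedBall (0 : ℂ) 1 ∩ (fun z ↦ ‖W z‖ ^ 2) ⁻¹' Iic R)ᶜ := by
    rintro ⟨h1, h2⟩
    have : ‖z‖ = 1 := le_antisymm (by simpa using h1) (by simpa using hz)
    exact absurd (hb z this) (not_lt.2 h2)
  filter_upwards [hK.isOpen_compl.mem_nhds hzK] with y hy
  by_cases hy1 : y ∈ ball (0 : ℂ) 1
  · have : R < ‖W y‖ ^ 2 := by
      by_contra h
      exact hy ⟨ball_subset_closedBall hy1, not_lt.1 h⟩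
    simp [cutoff, hφ0 _ this.le]
  · simp [cutoff, hy1]

theorem differentiable_cutoff (hW : ContinuousOn W (closedBall 0 1))
    (hd : ∀ z ∈ ball (0 : ℂ) 1, DifferentiableAt ℝ W z)
    (hb : ∀ z : ℂ, ‖z‖ = 1 → R < ‖W z‖ ^ 2) (hφ : ∀ s, 0 ≤ s → HasDerivAt φ (φ' s) s)
    (hφ0 : ∀ s, R ≤ s → φ s = 0) : Differentiable ℝ (cutoff φ W) := by
  intro z
  by_cases hz : z ∈ ball (0 : ℂ) 1
  · exact (hasFDerivAt_cutoff hz (hd z hz) (hφ _ (by positivity))).differentiableAt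
  · exact ((cutoff_eventuallyEq_zero hW hb hφ0 hz).differentiableAt_iff).2
      (differentiableAt_const 0)

theorem fderiv_cutoff_eq_zero (hW : ContinuousOn W (closedBall 0 1))
    (hd : ∀ z ∈ ball (0 : ℂ) 1, DifferentiableAt ℝ W z)
    (hb : ∀ z : ℂ, ‖z‖ = 1 → R < ‖W z‖ ^ 2) (hφ : ∀ s, 0 ≤ s → HasDerivAt φ (φ' s) s)
    (hφ0 : ∀ s, R ≤ s → φ s = 0) (hφ0' : ∀ s, R ≤ s → φ' s = 0) {z : ℂ}
    (hz : z ∉ sublevel W R) : fderiv ℝ (cutoff φ W) z = 0 := by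
  by_cases hz1 : z ∈ ball (0 : ℂ) 1
  · have hR : R ≤ ‖W z‖ ^ 2 := by
      by_contra h
      exact hz ⟨hz1, not_le.1 h⟩
    rw [(hasFDerivAt_cutoff hz1 (hd z hz1) (hφ _ (by positivity))).fderiv]
    ext v
    simp [hφ0 _ hR, hφ0' _ hR]
  · rw [(cutoff_eventuallyEq_zero hW hb hφ0 hz1).fderiv_eq]
    simp

theorem integrable_cutoff (hW : ContinuousOn W (closedBall 0 1))
    (hd : ∀ z ∈ ball (0 : ℂ) 1, DifferentiableAt ℝ W z)
    (hb : ∀ z : ℂ, ‖z‖ = 1 → R < ‖W z‖ ^ 2) (hφ : ∀ s, 0 ≤ s → HasDerivAt φ (φ' s) s)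
    (hφ0 : ∀ s, R ≤ s → φ s = 0) : Integrable (cutoff φ W) := by
  refine (differentiable_cutoff hW hd hb hφ hφ0).continuous.integrable_of_hasCompactSupport ?_
  refine HasCompactSupport.intro (isCompact_closedBall (0 : ℂ) 1) fun z hz ↦ ?_
  exact indicator_of_notMem (fun h ↦ hz (ball_subset_closedBall h)) _

theorem memLp_fderiv_cutoff [FiniteDimensional ℝ H] (hW : ContinuousOn W (closedBall 0 1))
    (hd : ∀ z ∈ ball (0 : ℂ) 1, DifferentiableAt ℝ W z)
    (hb : ∀ z : ℂ, ‖z‖ = 1 → R < ‖W z‖ ^ 2) (hφ : ∀ s, 0 ≤ s → HasDerivAt φ (φ' s) s)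
    (hφc : ContinuousOn φ' (Ici 0))
    (hφ0 : ∀ s, R ≤ s → φ s = 0) (hφ0' : ∀ s, R ≤ s → φ' s = 0)
    (hfin : IntegrableOn (energyDensity W) (sublevel W R)) :
    Integrable (fderiv ℝ (cutoff φ W)) ∧ MemLp (fderiv ℝ (cutoff φ W)) 2 := by
  have : CompleteSpace H := FiniteDimensional.complete ℝ H
  have hmeas : AEStronglyMeasurable (fderiv ℝ (cutoff φ W)) volume :=
    (measurable_fderiv ℝ _).aestronglyMeasurable
  obtain ⟨M, hM⟩ := isCompact_Icc.exists_bound_of_continuousOn (s := Icc (0 : ℝ) R) (f := φ)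
    fun s hs ↦ (hφ s hs.1).continuousAt.continuousWithinAt
  obtain ⟨M', hM'⟩ := isCompact_Icc.exists_bound_of_continuousOn (s := Icc (0 : ℝ) R)
    (hφc.mono Icc_subset_Ici_self)
  have hzero : ∀ z ∉ sublevel W R, fderiv ℝ (cutoff φ W) z = 0 := fun z hz ↦
    fderiv_cutoff_eq_zero hW hd hb hφ hφ0 hφ0' hz
  have hbound : ∀ z ∈ sublevel W R,
      ‖fderiv ℝ (cutoff φ W) z‖ ≤ (M + 2 * M' * R) * ‖fderiv ℝ W z‖ := by
    rintro z ⟨hz, hzR⟩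
    have hN : ‖W z‖ ^ 2 ∈ Icc 0 R := ⟨by positivity, le_of_lt hzR⟩
    rw [(hasFDerivAt_cutoff hz (hd z hz) (hφ _ hN.1)).fderiv]
    have h1 := hM _ hN
    have h2 := hM' _ hN
    calc _ ≤ ‖φ (‖W z‖ ^ 2) • fderiv ℝ W z‖ + ‖(φ' (‖W z‖ ^ 2) •
            (2 • (innerSL ℝ (W z)).comp (fderiv ℝ W z))).smulRight (W z)‖ := norm_add_le _ _
      _ ≤ M * ‖fderiv ℝ W z‖ + (M' * (2 * (‖W z‖ * ‖fderiv ℝ W z‖))) * ‖W z‖ := by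
          rw [ContinuousLinearMap.norm_smulRight_apply, norm_smul, norm_smul]
          have h3 : ‖(2 • (innerSL ℝ (W z)).comp (fderiv ℝ W z))‖ ≤
              2 * (‖W z‖ * ‖fderiv ℝ W z‖) := by
            refine (norm_nsmul_le).trans ?_
            push_cast
            gcongr
            refine (ContinuousLinearMap.opNorm_comp_le _ _).trans ?_
            rw [innerSL_apply_norm]
          have : 0 ≤ M' := (norm_nonneg _).trans h2
          gcongr
      _ = (M + 2 * M' * ‖W z‖ ^ 2) * ‖fderiv ℝ W z‖ := by ring
      _ ≤ _ := by
          have : 0 ≤ M' := (norm_nonneg _).trans h2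
          gcongr
          exact hN.2
  have h2 : MemLp (fderiv ℝ (cutoff φ W)) 2 := by
    rw [memLp_two_iff_integrable_sq_norm hmeas]
    have hint : Integrable ((sublevel W R).indicator
        fun z ↦ (M + 2 * M' * R) ^ 2 * (2 * energyDensity W z)) := by
      rw [integrable_indicator_iff
        (isOpen_sublevel (hW.mono ball_subset_closedBall) R).measurableSet]
      exact (hfin.const_mul 2).const_mul _
    refine hint.mono' (hmeas.norm.pow 2) (Eventually.of_forall fun z ↦ ?_)
    by_cases hz : z ∈ sublevel W R
    · rw [indicator_of_mem hz, Real.norm_of_nonneg (by positivity)]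
      calc _ ≤ ((M + 2 * M' * R) * ‖fderiv ℝ W z‖) ^ 2 := by
            gcongr
            exact hbound z hz
        _ = (M + 2 * M' * R) ^ 2 * ‖fderiv ℝ W z‖ ^ 2 := by ring
        _ ≤ _ := by
            gcongr
            exact sq_norm_fderiv_le_energyDensity W z
    · simp [indicator_of_notMem hz, hzero z hz]
  refine ⟨?_, h2⟩
  have hone : Integrable ((ball (0 : ℂ) 1).indicator fun _ ↦ (1 : ℝ)) :=
    (integrable_indicator_iff measurableSet_ball).2 (integrableOn_const measure_ball_lt_top.ne)
  refine (hone.add ((memLp_two_iff_integrable_sq_norm hmeas).1 h2)).mono' hmeas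
    (Eventually.of_forall fun z ↦ ?_)
  by_cases hz : z ∈ ball (0 : ℂ) 1
  · simp only [Pi.add_apply, indicator_of_mem hz]
    nlinarith [sq_nonneg (‖fderiv ℝ (cutoff φ W) z‖ - 1)]
  · rw [hzero z fun h ↦ hz h.1]
    simp [indicator_of_notMem hz]

end Cutoff

section Pointwise

variable {H : Type*} [NormedAddCommGroup H] [InnerProductSpace ℝ H]

/-- For an almost complex-linear pair `(a, b)`, i.e. `b ≈ S a`, the area form controls the energy. -/
theorem energy_le_area {S : H →L[ℝ] H} (hS : ∀ x y, inner ℝ (S x) (S y) = inner ℝ x y)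
    (hSS : ∀ x, S (S x) = -x) {a b : H} {θ : ℝ} (hθ : 0 ≤ θ)
    (hξ : ‖b - S a‖ ≤ θ * ‖a‖) (hη : ‖a + S b‖ ≤ θ * ‖b‖) :
    (1 - 9 * θ) * (‖a‖ ^ 2 + ‖b‖ ^ 2) ≤ 2 * inner ℝ (S a) b := by
  have e1 : inner ℝ (S a) b = ‖b‖ ^ 2 - inner ℝ (b - S a) b := by
    rw [inner_sub_left, real_inner_self_eq_norm_sq]; ring
  have e2 : inner ℝ (S a) b = ‖a‖ ^ 2 - inner ℝ a (a + S b) := by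
    rw [inner_add_right, real_inner_self_eq_norm_sq, ← hS (S a) b, hSS, inner_neg_left]; ring
  have b1 := real_inner_le_norm (b - S a) b
  have b2 := real_inner_le_norm a (a + S b)
  have c1 : ‖b - S a‖ * ‖b‖ ≤ θ * ‖a‖ * ‖b‖ := by gcongr
  have c2 : ‖a‖ * ‖a + S b‖ ≤ ‖a‖ * (θ * ‖b‖) := by gcongr
  have c3 : 0 ≤ θ * (‖a‖ - ‖b‖) ^ 2 := by positivity
  have c4 : 0 ≤ θ * (‖a‖ ^ 2 + ‖b‖ ^ 2) := by positivity
  nlinarith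

theorem sq_norm_le_energy {S : H →L[ℝ] H} (hS : ∀ x y, inner ℝ (S x) (S y) = inner ℝ x y)
    (hSS : ∀ x, S (S x) = -x) {a b : H} {θ : ℝ} (hθ : 0 ≤ θ)
    (hξ : ‖b - S a‖ ≤ θ * ‖a‖) (hη : ‖a + S b‖ ≤ θ * ‖b‖) :
    2 * ‖a‖ ^ 2 ≤ (1 + θ) * (‖a‖ ^ 2 + ‖b‖ ^ 2) := by
  have e1 : inner ℝ (S a) b = ‖b‖ ^ 2 - inner ℝ (b - S a) b := by
    rw [inner_sub_left, real_inner_self_eq_norm_sq]; ring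
  have e2 : inner ℝ (S a) b = ‖a‖ ^ 2 - inner ℝ a (a + S b) := by
    rw [inner_add_right, real_inner_self_eq_norm_sq, ← hS (S a) b, hSS, inner_neg_left]; ring
  have b1 := (abs_le.1 (abs_real_inner_le_norm (b - S a) b)).1
  have b2 := real_inner_le_norm a (a + S b)
  have c1 : ‖b - S a‖ * ‖b‖ ≤ θ * ‖a‖ * ‖b‖ := by gcongr
  have c2 : ‖a‖ * ‖a + S b‖ ≤ ‖a‖ * (θ * ‖b‖) := by gcongr
  have c3 : 0 ≤ θ * (‖a‖ - ‖b‖) ^ 2 := by positivity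
  nlinarith

/-- Bessel's inequality for the orthogonal pair `a`, `S a`. -/
theorem inner_sq_add_inner_sq_le {S : H →L[ℝ] H}
    (hS : ∀ x y, inner ℝ (S x) (S y) = inner ℝ x y) (hSS : ∀ x, S (S x) = -x) (w a : H) :
    inner ℝ w a ^ 2 + inner ℝ w (S a) ^ 2 ≤ ‖w‖ ^ 2 * ‖a‖ ^ 2 := by
  set p := inner ℝ w a
  set t := inner ℝ w (S a)
  have horth : inner ℝ a (S a) = 0 := by
    have := hS a (S a)
    rw [hSS, inner_neg_right, real_inner_comm] at this
    linarith
  have h1 : inner ℝ w (p • a + t • S a) = p ^ 2 + t ^ 2 := by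
    rw [inner_add_right, inner_smul_right, inner_smul_right]; ring
  have h2 : ‖p • a + t • S a‖ ^ 2 = (p ^ 2 + t ^ 2) * ‖a‖ ^ 2 := by
    rw [← real_inner_self_eq_norm_sq]
    simp only [inner_add_left, inner_add_right, real_inner_smul_left, inner_smul_right, hS,
      real_inner_comm a (S a), horth, real_inner_self_eq_norm_sq]
    ring
  have h3 := real_inner_mul_inner_self_le w (p • a + t • S a)
  rw [h1, real_inner_self_eq_norm_sq, real_inner_self_eq_norm_sq, h2] at h3
  rcases (by positivity : 0 ≤ p ^ 2 + t ^ 2).eq_or_lt with h | h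
  · rw [← h]; positivity
  · nlinarith

theorem radial_term_le {S : H →L[ℝ] H} (hS : ∀ x y, inner ℝ (S x) (S y) = inner ℝ x y)
    (hSS : ∀ x, S (S x) = -x) {a b : H} {θ : ℝ} (hθ : 0 ≤ θ) (hθ1 : θ ≤ 1)
    (hξ : ‖b - S a‖ ≤ θ * ‖a‖) (hη : ‖a + S b‖ ≤ θ * ‖b‖) (w : H) :
    2 * (inner ℝ w a * inner ℝ (S w) b - inner ℝ w b * inner ℝ (S w) a) ≤
      (1 + 9 * θ) * (‖w‖ ^ 2 * (‖a‖ ^ 2 + ‖b‖ ^ 2)) := by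
  have e1 : inner ℝ (S w) b = inner ℝ w a - inner ℝ w (a + S b) := by
    rw [inner_add_right, ← hS w (S b), hSS, inner_neg_right]; ring
  have e2 : inner ℝ (S w) a = -inner ℝ w b + inner ℝ w (b - S a) := by
    rw [inner_sub_right, ← hS w (S a), hSS, inner_neg_right]; ring
  have e3 : inner ℝ w b = inner ℝ w (S a) + inner ℝ w (b - S a) := by
    rw [inner_sub_right]; ring
  have hbes := inner_sq_add_inner_sq_le hS hSS w a
  have hX := sq_norm_le_energy hS hSS hθ hξ hη
  set N := ‖w‖ ^ 2 with hN
  have hN0 : 0 ≤ N := by positivity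
  have bp := abs_real_inner_le_norm w a
  have bq := abs_real_inner_le_norm w b
  have bt : |inner ℝ w (S a)| ≤ ‖w‖ * ‖a‖ := by
    refine (abs_real_inner_le_norm w (S a)).trans_eq ?_
    have : ‖S a‖ ^ 2 = ‖a‖ ^ 2 := by
      rw [← real_inner_self_eq_norm_sq, hS, real_inner_self_eq_norm_sq]
    rw [(sq_eq_sq₀ (norm_nonneg _) (norm_nonneg _)).1 this]
  have bη : |inner ℝ w (a + S b)| ≤ ‖w‖ * (θ * ‖b‖) :=
    (abs_real_inner_le_norm _ _).trans (by gcongr)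
  have bξ : |inner ℝ w (b - S a)| ≤ ‖w‖ * (θ * ‖a‖) :=
    (abs_real_inner_le_norm _ _).trans (by gcongr)
  set p := inner ℝ w a
  set q := inner ℝ w b
  set t := inner ℝ w (S a)
  set m := inner ℝ w (b - S a)
  set l := inner ℝ w (a + S b)
  have mul_bound : ∀ {x y X Y : ℝ}, |x| ≤ X → |y| ≤ Y → |x * y| ≤ X * Y := fun hx hy ↦ by
    rw [abs_mul]; exact mul_le_mul hx hy (abs_nonneg _) ((abs_nonneg _).trans hx)
  have hpl : -(p * l) ≤ N * θ * (‖a‖ * ‖b‖) := by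
    have := (abs_le.1 (mul_bound bp bη)).1
    rw [hN]; linarith
  have hqm : -(q * m) ≤ N * θ * (‖a‖ * ‖b‖) := by
    have := (abs_le.1 (mul_bound bq bξ)).1
    rw [hN]; linarith
  have htm : t * m ≤ N * θ * ‖a‖ ^ 2 := by
    have := (abs_le.1 (mul_bound bt bξ)).2
    rw [hN]; linarith
  have hmm : m * m ≤ N * θ * ‖a‖ ^ 2 := by
    have := (abs_le.1 (mul_bound bξ bξ)).2
    have h2 : N * ‖a‖ ^ 2 * (θ * θ) ≤ N * ‖a‖ ^ 2 * (θ * 1) := by gcongr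
    rw [hN] at h2 ⊢; nlinarith
  have hab : 2 * (‖a‖ * ‖b‖) ≤ ‖a‖ ^ 2 + ‖b‖ ^ 2 := by nlinarith [sq_nonneg (‖a‖ - ‖b‖)]
  set e := ‖a‖ ^ 2 + ‖b‖ ^ 2
  have he : 0 ≤ e := by positivity
  have hab' : N * θ * (2 * (‖a‖ * ‖b‖)) ≤ N * θ * e := by gcongr
  have hpq : p ^ 2 + q ^ 2 ≤ (1 + 3 * θ) * (N * ‖a‖ ^ 2) := by
    rw [e3]; nlinarith
  have h5 : (1 + 3 * θ) * N * (2 * ‖a‖ ^ 2) ≤ (1 + 3 * θ) * N * ((1 + θ) * e) := by gcongr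
  have h6 : N * e * θ * θ ≤ N * e * θ * 1 := by gcongr
  rw [e1, e2]
  nlinarith

end Pointwise

section TestFunction

theorem hasDerivAt_max_zero_sq (x : ℝ) : HasDerivAt (fun x : ℝ ↦ max 0 x ^ 2) (2 * max 0 x) x := by
  rcases lt_trichotomy x 0 with h | rfl | h
  · rw [max_eq_left h.le, mul_zero]
    refine (hasDerivAt_const x (0 : ℝ)).congr_of_eventuallyEq ?_
    filter_upwards [gt_mem_nhds h] with y hy
    simp [max_eq_left hy.le]
  · rw [max_self, mul_zero, hasDerivAt_iff_isLittleO]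
    have h2 : (fun x : ℝ ↦ x ^ 2) =o[nhds 0] fun x ↦ x := by
      simpa using Asymptotics.isLittleO_pow_pow (𝕜 := ℝ) (m := 1) (n := 2) one_lt_two
    simp only [max_self, smul_zero, sub_zero, ne_eq, OfNat.ofNat_ne_zero, not_false_eq_true,
      zero_pow]
    refine (Asymptotics.IsBigO.of_bound 1 (Filter.Eventually.of_forall fun y ↦ ?_)).trans_isLittleO h2
    rw [one_mul, Real.norm_of_nonneg (sq_nonneg _), Real.norm_of_nonneg (sq_nonneg _)]
    rcases le_total 0 y with hy | hy
    · rw [max_eq_right hy]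
    · rw [max_eq_left hy, zero_pow two_ne_zero]; positivity
  · rw [max_eq_right h.le]
    have := hasDerivAt_pow 2 x
    simp only [Nat.cast_ofNat, Nat.add_one_sub_one, pow_one] at this
    refine this.congr_of_eventuallyEq ?_
    filter_upwards [lt_mem_nhds h] with y hy
    simp [max_eq_right hy.le]

/-- The radial weight `(1 + σ^β) (1 - s/R)₊² / σ`, `σ = s + a`, used to test monotonicity. -/
noncomputable def weight (β a R s : ℝ) : ℝ :=
  (1 + (s + a) ^ β) * max 0 (1 - s / R) ^ 2 / (s + a)

/-- The derivative of `weight`. -/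
noncomputable def weightDeriv (β a R s : ℝ) : ℝ :=
  β * (s + a) ^ β * max 0 (1 - s / R) ^ 2 / (s + a) ^ 2 -
    2 * (1 + (s + a) ^ β) * max 0 (1 - s / R) / (R * (s + a)) -
    (1 + (s + a) ^ β) * max 0 (1 - s / R) ^ 2 / (s + a) ^ 2

variable {β a R s : ℝ}

theorem hasDerivAt_weight (ha : 0 < a) (hR : 0 < R) (hs : 0 ≤ s) :
    HasDerivAt (weight β a R) (weightDeriv β a R s) s := by
  have hσ : 0 < s + a := by positivity
  have h0 : HasDerivAt (fun s : ℝ ↦ s + a) 1 s := (hasDerivAt_id s).add_const a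
  have h1 : HasDerivAt (fun s : ℝ ↦ 1 + (s + a) ^ β) (1 * β * (s + a) ^ (β - 1)) s :=
    (h0.rpow_const (Or.inl hσ.ne')).const_add 1
  have h2 : HasDerivAt (fun s : ℝ ↦ max 0 (1 - s / R) ^ 2)
      (2 * max 0 (1 - s / R) * -(1 / R)) s :=
    (hasDerivAt_max_zero_sq (1 - s / R)).comp (h := fun s ↦ 1 - s / R) s
      (((hasDerivAt_id' s).div_const R).const_sub 1)
  refine ((h1.mul h2).div h0 hσ.ne').congr_deriv ?_
  rw [Real.rpow_sub_one hσ.ne', weightDeriv]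
  simp only [Pi.mul_apply]
  field_simp
  ring

theorem continuousOn_weightDeriv (ha : 0 < a) (hR : 0 < R) :
    ContinuousOn (weightDeriv β a R) (Set.Ici 0) := by
  have h1 : ContinuousOn (fun s : ℝ ↦ (s + a) ^ β) (Set.Ici 0) := fun s (hs : 0 ≤ s) ↦
    ((continuous_id.add continuous_const).continuousAt.rpow_const
      (Or.inl (by change s + a ≠ 0; positivity))).continuousWithinAt
  have h2 : ContinuousOn (fun s : ℝ ↦ max 0 (1 - s / R)) (Set.Ici 0) :=
    (continuous_const.max (continuous_const.sub (continuous_id.div_const R))).continuousOn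
  have h3 : ContinuousOn (fun s : ℝ ↦ s + a) (Set.Ici 0) :=
    (continuous_id.add continuous_const).continuousOn
  have hσ : ∀ s ∈ Set.Ici (0 : ℝ), s + a ≠ 0 := fun s (hs : 0 ≤ s) ↦ by positivity
  unfold weightDeriv
  refine ContinuousOn.sub (ContinuousOn.sub ?_ ?_) ?_
  · exact ((continuousOn_const.mul h1).mul (h2.pow 2)).div (h3.pow 2)
      fun s hs ↦ pow_ne_zero 2 (hσ s hs)
  · exact ((continuousOn_const.mul (continuousOn_const.add h1)).mul h2).div
      (continuousOn_const.mul h3) fun s hs ↦ mul_ne_zero hR.ne' (hσ s hs)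
  · exact ((continuousOn_const.add h1).mul (h2.pow 2)).div (h3.pow 2)
      fun s hs ↦ pow_ne_zero 2 (hσ s hs)

theorem weight_eq_zero (hR : 0 < R) (hs : R ≤ s) : weight β a R s = 0 := by
  have : max 0 (1 - s / R) = 0 := max_eq_left (by rw [sub_nonpos, one_le_div hR]; exact hs)
  simp [weight, this]

theorem weightDeriv_eq_zero (hR : 0 < R) (hs : R ≤ s) : weightDeriv β a R s = 0 := by
  have : max 0 (1 - s / R) = 0 := max_eq_left (by rw [sub_nonpos, one_le_div hR]; exact hs)
  simp [weightDeriv, this]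

theorem weight_nonneg (ha : 0 < a) (hs : 0 ≤ s) : 0 ≤ weight β a R s := by
  unfold weight; positivity

theorem weightDeriv_nonpos (hβ : β ≤ 1) (ha : 0 < a) (hR : 0 < R) (hs : 0 ≤ s) :
    weightDeriv β a R s ≤ 0 := by
  unfold weightDeriv
  have h1 : β * (s + a) ^ β * max 0 (1 - s / R) ^ 2 / (s + a) ^ 2 ≤
      (1 + (s + a) ^ β) * max 0 (1 - s / R) ^ 2 / (s + a) ^ 2 := by
    have : 0 ≤ (s + a) ^ β := by positivity
    gcongr
    nlinarith
  have h2 : 0 ≤ 2 * (1 + (s + a) ^ β) * max 0 (1 - s / R) / (R * (s + a)) := by positivity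
  linarith

theorem weight_lower_bound (hβ0 : 0 < β) (hβ : β ≤ 1) (ha : 0 < a) (hs : 0 ≤ s)
    (hR : 0 < R) (hσ1 : s + a ≤ 1) {θ : ℝ} (hθ : 0 ≤ θ) (hθ1 : θ ≤ 1)
    (hθβ : θ ≤ β / 4 * (s + a) ^ β) :
    a * max 0 (1 - s / R) ^ 2 / (s + a) ^ 2 - 8 / R ≤
      weight β a R s * (1 - θ) + s * weightDeriv β a R s * (1 + θ) := by
  have hσ : 0 < s + a := by positivity
  have hP0 : 0 ≤ (s + a) ^ β := by positivity
  have hP1 : (s + a) ^ β ≤ 1 := Real.rpow_le_one hσ.le hσ1 hβ0.le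
  have hμ0 : 0 ≤ max 0 (1 - s / R) := le_max_left _ _
  have hμ1 : max 0 (1 - s / R) ≤ 1 := max_le zero_le_one (by
    have : 0 ≤ s / R := by positivity
    linarith)
  unfold weight weightDeriv
  set P := (s + a) ^ β
  set μ := max 0 (1 - s / R)
  have hrad : 2 * (1 + P) * μ / (R * (s + a)) * s * (1 + θ) ≤ 8 / R := by
    have : s / (s + a) ≤ 1 := (div_le_one hσ).2 (by linarith)
    calc _ = 2 * (1 + P) * μ * (s / (s + a)) * (1 + θ) / R := by field_simp
      _ ≤ 2 * (1 + 1) * 1 * 1 * (1 + 1) / R := by gcongr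
      _ = 8 / R := by norm_num
  have hmain : a ≤ (1 + P) * (s + a) * (1 - θ) - s * (1 + P - β * P) * (1 + θ) := by
    have h1 : θ * (1 + P) * (s + a) ≤ β / 4 * P * (1 + 1) * (s + a) := by gcongr
    have h2 : θ * (s * (1 + P - β * P)) ≤ θ * ((1 + P) * (s + a)) := by
      gcongr ?_ * ?_
      nlinarith [mul_nonneg hs hP0, mul_nonneg (mul_nonneg hs hP0) hβ0.le, mul_nonneg ha.le hP0]
    nlinarith [mul_nonneg ha.le (mul_nonneg hP0 (sub_nonneg.2 hβ))]
  have hmain' := mul_le_mul_of_nonneg_right hmain (by positivity : 0 ≤ μ ^ 2 / (s + a) ^ 2)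
  calc _ = a * (μ ^ 2 / (s + a) ^ 2) - 8 / R := by ring
    _ ≤ ((1 + P) * (s + a) * (1 - θ) - s * (1 + P - β * P) * (1 + θ)) * (μ ^ 2 / (s + a) ^ 2) -
        2 * (1 + P) * μ / (R * (s + a)) * s * (1 + θ) := by linarith
    _ = _ := by field_simp; ring

end TestFunction

section Monotonicity
open Metric Set Filter Topology

/-- A smooth function equal to `1` on `(-∞, R]` and to `0` on `[R₁, ∞)`. -/
noncomputable def plateau (R R₁ s : ℝ) : ℝ := Real.smoothTransition ((R₁ - s) / (R₁ - R))

variable {R R₁ : ℝ}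

theorem contDiff_plateau : ContDiff ℝ 1 (plateau R R₁) :=
  Real.smoothTransition.contDiff.comp ((contDiff_const.sub contDiff_id).div_const _)

theorem plateau_eq_one (h : R < R₁) {s : ℝ} (hs : s ≤ R) : plateau R R₁ s = 1 :=
  Real.smoothTransition.one_of_one_le ((one_le_div (by linarith)).2 (by linarith))

theorem plateau_eq_zero (h : R < R₁) {s : ℝ} (hs : R₁ ≤ s) : plateau R R₁ s = 0 :=
  Real.smoothTransition.zero_of_nonpos (div_nonpos_of_nonpos_of_nonneg (by linarith) (by linarith))

theorem deriv_plateau_eq_zero (h : R < R₁) {s : ℝ} (hs : s ≤ R ∨ R₁ ≤ s) :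
    deriv (plateau R R₁) s = 0 := by
  rcases hs with hs | hs
  · refine IsLocalMax.deriv_eq_zero (Eventually.of_forall fun t ↦ ?_)
    rw [plateau_eq_one h hs]
    exact Real.smoothTransition.le_one _
  · refine IsLocalMin.deriv_eq_zero (Eventually.of_forall fun t ↦ ?_)
    rw [plateau_eq_zero h hs]
    exact Real.smoothTransition.nonneg _

variable {H : Type*} [NormedAddCommGroup H] [InnerProductSpace ℝ H]

theorem energy_mul_le_crossed_form {S : H →L[ℝ] H}
    (hS : ∀ x y, inner ℝ (S x) (S y) = inner ℝ x y) (hSS : ∀ x, S (S x) = -x) {w a b : H}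
    {β ρ : ℝ} (hβ0 : 0 < β) (hβ : β ≤ 1) (hρ : 0 < ρ) (hR : 0 < R) (hw : ‖w‖ ^ 2 < R)
    (hRρ : R + ρ ≤ 1)
    (hξ : ‖b - S a‖ ≤ β / 36 * (‖w‖ ^ 2) ^ β * ‖a‖)
    (hη : ‖a + S b‖ ≤ β / 36 * (‖w‖ ^ 2) ^ β * ‖b‖) :
    (‖a‖ ^ 2 + ‖b‖ ^ 2) *
        (ρ * max 0 (1 - ‖w‖ ^ 2 / R) ^ 2 / (‖w‖ ^ 2 + ρ) ^ 2 - 8 / R) ≤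
      weight β ρ R (‖w‖ ^ 2) * (inner ℝ (S a) b - inner ℝ (S b) a) +
        weightDeriv β ρ R (‖w‖ ^ 2) *
          (2 * (inner ℝ w a * inner ℝ (S w) b - inner ℝ w b * inner ℝ (S w) a)) := by
  set N := ‖w‖ ^ 2
  have hN : 0 ≤ N := by positivity
  have hNβ : N ^ β ≤ (N + ρ) ^ β := Real.rpow_le_rpow hN (by linarith) hβ0.le
  have hN1 : N ^ β ≤ 1 := Real.rpow_le_one hN (by linarith) hβ0.le
  have hNβ0 : 0 ≤ N ^ β := by positivity
  have hθ0 : 0 ≤ β / 36 * N ^ β := by positivity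
  have hθ1 : β / 36 * N ^ β ≤ 1 / 36 * 1 := by gcongr
  have hs : inner ℝ (S b) a = -inner ℝ (S a) b := by
    rw [← hS, hSS, inner_neg_left, real_inner_comm]
  have h1 := energy_le_area hS hSS hθ0 hξ hη
  have h2 := radial_term_le hS hSS hθ0 (by linarith) hξ hη w
  have h3 := weight_lower_bound hβ0 hβ hρ hN hR (by linarith : N + ρ ≤ 1)
    (θ := 9 * (β / 36 * N ^ β)) (by positivity) (by linarith) (by nlinarith)
  have h4 := mul_le_mul_of_nonneg_left h1 (weight_nonneg (β := β) (R := R) hρ hN)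
  have h5 := mul_le_mul_of_nonpos_left h2 (weightDeriv_nonpos (R := R) hβ hρ hR hN)
  have h6 := mul_le_mul_of_nonneg_left h3 (by positivity : 0 ≤ ‖a‖ ^ 2 + ‖b‖ ^ 2)
  rw [hs]
  linarith

/-- Monotonicity: the energy over `{|W|² < ρ}` grows at least linearly in `ρ`. -/
theorem energy_sublevel_le [FiniteDimensional ℝ H] {S : H →L[ℝ] H}
    (hS : ∀ x y, inner ℝ (S x) (S y) = inner ℝ x y) (hSS : ∀ x, S (S x) = -x) {W : ℂ → H}
    {β ρ : ℝ} (hβ0 : 0 < β) (hβ : β ≤ 1) (hρ : 0 < ρ) (hρR : ρ ≤ R / 2) (hRρ : R + ρ ≤ 1)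
    (hRR : R < R₁) (hW : ContinuousOn W (closedBall 0 1))
    (hd : ∀ z ∈ ball (0 : ℂ) 1, DifferentiableAt ℝ W z)
    (hb : ∀ z : ℂ, ‖z‖ = 1 → R₁ < ‖W z‖ ^ 2)
    (hξ : ∀ z ∈ ball (0 : ℂ) 1, ‖fderiv ℝ W z Complex.I - S (fderiv ℝ W z 1)‖ ≤
      β / 36 * (‖W z‖ ^ 2) ^ β * ‖fderiv ℝ W z 1‖)
    (hη : ∀ z ∈ ball (0 : ℂ) 1, ‖fderiv ℝ W z 1 + S (fderiv ℝ W z Complex.I)‖ ≤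
      β / 36 * (‖W z‖ ^ 2) ^ β * ‖fderiv ℝ W z Complex.I‖)
    (hfin : IntegrableOn (energyDensity W) (sublevel W R₁)) :
    ∫ z in sublevel W ρ, energyDensity W z ≤
      128 * ρ / R * ∫ z in sublevel W R, energyDensity W z := by
  have hR : 0 < R := by linarith
  have hWb := hW.mono ball_subset_closedBall
  have hfinR := hfin.mono_set (sublevel_subset W hRR.le)
  have hb' : ∀ z : ℂ, ‖z‖ = 1 → R < ‖W z‖ ^ 2 := fun z hz ↦ hRR.trans (hb z hz)
  set f := cutoff (weight β ρ R) W with hf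
  set g := cutoff (plateau R R₁) W with hg
  have hw (s : ℝ) (hs : 0 ≤ s) := hasDerivAt_weight (β := β) hρ hR hs
  have hp (s : ℝ) (_ : 0 ≤ s) : HasDerivAt (plateau R R₁) (deriv (plateau R R₁) s) s :=
    (contDiff_plateau.differentiable one_ne_zero s).hasDerivAt
  have hw0 (s : ℝ) (hs : R ≤ s) := weight_eq_zero (β := β) (a := ρ) hR hs
  have hw0' (s : ℝ) (hs : R ≤ s) := weightDeriv_eq_zero (β := β) (a := ρ) hR hs
  have hp0 (s : ℝ) (hs : R₁ ≤ s) := plateau_eq_zero hRR hs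
  have hp0' (s : ℝ) (hs : R₁ ≤ s) := deriv_plateau_eq_zero hRR (Or.inr hs)
  have hf1 := integrable_cutoff hW hd hb' hw hw0
  have hg1 := integrable_cutoff hW hd hb hp hp0
  have hf2 := differentiable_cutoff hW hd hb' hw hw0
  have hg2 := differentiable_cutoff hW hd hb hp hp0
  obtain ⟨hf3, hf4⟩ := memLp_fderiv_cutoff hW hd hb' hw (continuousOn_weightDeriv hρ hR) hw0 hw0'
    hfinR
  obtain ⟨hg3, hg4⟩ := memLp_fderiv_cutoff hW hd hb hp
    (contDiff_plateau.continuous_deriv le_rfl).continuousOn hp0 hp0' hfin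
  obtain ⟨i1, e1⟩ := integral_inner_fderiv_comm S hf1 hf2 hf3 hf4 hg1 hg2 hg3 hg4 1 Complex.I
  obtain ⟨i2, -⟩ := integral_inner_fderiv_comm S hf1 hf2 hf3 hf4 hg1 hg2 hg3 hg4 Complex.I 1
  have hzero : ∫ z in sublevel W R, (inner ℝ (S (fderiv ℝ f z 1)) (fderiv ℝ g z Complex.I) -
      inner ℝ (S (fderiv ℝ f z Complex.I)) (fderiv ℝ g z 1)) = 0 := by
    rw [setIntegral_eq_integral_of_forall_compl_eq_zero, integral_sub i1 i2, e1, sub_self]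
    intro z hz
    rw [fderiv_cutoff_eq_zero hW hd hb' hw hw0 hw0' hz]
    simp
  have hpt : ∀ z ∈ sublevel W R, (sublevel W ρ).indicator (energyDensity W) z * (1 / (16 * ρ)) -
      energyDensity W z * (8 / R) ≤
      inner ℝ (S (fderiv ℝ f z 1)) (fderiv ℝ g z Complex.I) -
      inner ℝ (S (fderiv ℝ f z Complex.I)) (fderiv ℝ g z 1) := by
    rintro z ⟨hz, hzR⟩
    change ‖W z‖ ^ 2 < R at hzR
    have hN : 0 ≤ ‖W z‖ ^ 2 := by positivity
    have key := energy_mul_le_crossed_form hS hSS hβ0 hβ hρ hR hzR hRρ (hξ z hz) (hη z hz)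
    rw [hf, hg, (hasFDerivAt_cutoff hz (hd z hz) (hw _ hN)).fderiv,
      (hasFDerivAt_cutoff hz (hd z hz) (hp _ hN)).fderiv, plateau_eq_one hRR hzR.le,
      deriv_plateau_eq_zero hRR (Or.inl hzR.le)]
    simp only [add_apply, smul_apply, zero_apply,
      ContinuousLinearMap.smulRight_apply, ContinuousLinearMap.comp_apply, innerSL_apply_apply,
      map_add, map_smul, inner_add_left, real_inner_smul_left, one_smul, zero_smul, add_zero,
      smul_eq_mul, nsmul_eq_mul, Nat.cast_ofNat]
    have hind : (sublevel W ρ).indicator (energyDensity W) z * (1 / (16 * ρ)) ≤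
        energyDensity W z *
          (ρ * max 0 (1 - ‖W z‖ ^ 2 / R) ^ 2 / (‖W z‖ ^ 2 + ρ) ^ 2) := by
      by_cases hzρ : z ∈ sublevel W ρ
      · rw [indicator_of_mem hzρ]
        have hNρ : ‖W z‖ ^ 2 < ρ := hzρ.2
        refine mul_le_mul_of_nonneg_left ?_ (energyDensity_nonneg W z)
        have hμ : 1 / 2 ≤ max 0 (1 - ‖W z‖ ^ 2 / R) := le_max_of_le_right (by
          have : ‖W z‖ ^ 2 / R ≤ 1 / 2 := by rw [div_le_iff₀ hR]; linarith
          linarith)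
        calc 1 / (16 * ρ) = ρ * (1 / 2) ^ 2 / (ρ + ρ) ^ 2 := by field_simp; norm_num
          _ ≤ _ := by gcongr
      · rw [indicator_of_notMem hzρ, zero_mul]
        have := energyDensity_nonneg W z
        positivity
    have : energyDensity W z = ‖fderiv ℝ W z 1‖ ^ 2 + ‖fderiv ℝ W z Complex.I‖ ^ 2 := rfl
    rw [← this] at key
    linarith
  have hmR := (isOpen_sublevel hWb R).measurableSet
  have hmρ := (isOpen_sublevel hWb ρ).measurableSet
  have hint : IntegrableOn ((sublevel W ρ).indicator (energyDensity W)) (sublevel W R) :=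
    hfinR.indicator hmρ
  have hle := setIntegral_mono_on
    ((hint.mul_const (1 / (16 * ρ))).sub (hfinR.mul_const (8 / R)))
    (i1.sub i2).integrableOn hmR hpt
  simp only [Pi.sub_apply] at hle
  rw [hzero, integral_sub (hint.mul_const _) (hfinR.mul_const _), integral_mul_const,
    integral_mul_const, setIntegral_indicator hmρ,
    inter_eq_self_of_subset_right (sublevel_subset W (by linarith : ρ ≤ R))] at hle
  have h16 : ∀ x y : ℝ, x * (1 / (16 * ρ)) - y * (8 / R) ≤ 0 → x ≤ 128 * ρ / R * y := by
    intro x y h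
    have h' := mul_nonpos_of_nonneg_of_nonpos (by positivity : 0 ≤ 16 * ρ) h
    have : 16 * ρ * (x * (1 / (16 * ρ)) - y * (8 / R)) = x - 128 * ρ / R * y := by
      field_simp; ring
    linarith
  exact h16 _ _ hle

end Monotonicity

section SmallSquare
open Metric Set Filter Topology

theorem closedBall_eq_Icc_prod (p : ℝ × ℝ) (τ : ℝ) :
    closedBall p τ = Icc (p.1 - τ, p.2 - τ) (p.1 + τ, p.2 + τ) := by
  rw [← Icc_prod_Icc, ← Real.closedBall_eq_Icc, ← Real.closedBall_eq_Icc, closedBall_prod_same]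

theorem integral_closedBall_fderiv_ge {v : ℝ × ℝ → ℝ} {v' : ℝ × ℝ → ℝ × ℝ →L[ℝ] ℝ} {p : ℝ × ℝ}
    {τ η : ℝ} (hτ : 0 ≤ τ) (hv : ∀ q ∈ closedBall p τ, HasFDerivAt v (v' q) q)
    (hi : IntegrableOn (fun q ↦ v' q (1, 0)) (closedBall p τ))
    (hη : ∀ q ∈ closedBall p τ, |v q - v p - v' p (q - p)| ≤ η * ‖q - p‖) :
    4 * τ ^ 2 * (v' p (1, 0) - η) ≤ ∫ q in closedBall p τ, v' q (1, 0) := by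
  have hc : ContinuousOn v (closedBall p τ) := fun q hq ↦
    (hv q hq).continuousAt.continuousWithinAt
  have hmem (σ : ℝ) (hσ : |σ| = τ) (y : ℝ) (hy : y ∈ Icc (p.2 - τ) (p.2 + τ)) :
      (p.1 + σ, y) ∈ closedBall p τ ∧ ‖(p.1 + σ, y) - p‖ = τ := by
    have h : ‖(p.1 + σ, y) - p‖ = τ := by
      rw [Prod.norm_def]
      simp only [Prod.fst_sub, Prod.snd_sub, add_sub_cancel_left, Real.norm_eq_abs, hσ]
      exact max_eq_left (abs_le.2 ⟨by linarith [hy.1], by linarith [hy.2]⟩)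
    exact ⟨by rw [mem_closedBall, dist_eq_norm, h], h⟩
  have hsub : Ioo (p.1 - τ) (p.1 + τ) ×ˢ Ioo (p.2 - τ) (p.2 + τ) ⊆ closedBall p τ := by
    rw [closedBall_eq_Icc_prod, ← Icc_prod_Icc]
    exact prod_mono Ioo_subset_Icc_self Ioo_subset_Icc_self
  have key := integral_divergence_prod_Icc_of_hasFDerivAt_of_le v 0 v' 0
    (p.1 - τ, p.2 - τ) (p.1 + τ, p.2 + τ) ⟨by simp; linarith, by simp; linarith⟩
    (by rwa [← closedBall_eq_Icc_prod]) continuousOn_const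
    (fun q hq ↦ hv q (hsub hq)) (fun q _ ↦ hasFDerivAt_const 0 q)
    (by rw [← closedBall_eq_Icc_prod]; simpa using hi)
  simp only [Pi.zero_apply, zero_apply, add_zero, intervalIntegral.integral_zero, sub_self,
    zero_add] at key
  have hline (σ : ℝ) (hσ : |σ| = τ) :
      IntervalIntegrable (fun y ↦ v (p.1 + σ, y)) volume (p.2 - τ) (p.2 + τ) := by
    refine ContinuousOn.intervalIntegrable ?_
    rw [uIcc_of_le (by linarith)]
    exact hc.comp (by fun_prop) fun y hy ↦ (hmem σ hσ y hy).1
  have h1 := hline τ (abs_of_nonneg hτ)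
  have h2 := hline (-τ) (by rw [abs_neg, abs_of_nonneg hτ])
  rw [closedBall_eq_Icc_prod, key]
  simp only [← sub_eq_add_neg] at h2
  rw [← intervalIntegral.integral_sub h1 h2]
  have hmono := intervalIntegral.integral_mono_on (by linarith : p.2 - τ ≤ p.2 + τ)
    (intervalIntegrable_const (c := 2 * τ * (v' p (1, 0) - η))) (h1.sub h2) fun y hy ↦ by
      obtain ⟨m1, n1⟩ := hmem τ (abs_of_nonneg hτ) y hy
      obtain ⟨m2, n2⟩ := hmem (-τ) (by rw [abs_neg, abs_of_nonneg hτ]) y hy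
      have b1 := (abs_le.1 (hη _ m1)).1
      have b2 := (abs_le.1 (hη _ m2)).2
      rw [n1] at b1
      rw [n2] at b2
      have : v' p ((p.1 + τ, y) - p) - v' p ((p.1 + -τ, y) - p) = 2 * τ * v' p (1, 0) := by
        rw [← map_sub, ← smul_eq_mul, ← map_smul]
        congr 1
        ext <;> simp
        ring
      simp only [sub_eq_add_neg (p.1)]
      linarith
  refine le_trans (le_of_eq ?_) hmono
  rw [intervalIntegral.integral_const, smul_eq_mul]
  ring

variable {H : Type*} [NormedAddCommGroup H] [InnerProductSpace ℝ H]

/-- Near a zero with conformal nonzero derivative, the energy over `{|W|² < ρ}` is at least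
`ρ / 3`, for arbitrarily small `ρ`. -/
theorem exists_le_energy_sublevel [CompleteSpace H] {W : ℂ → H} {R δ : ℝ} {z₁ : ℂ}
    (hd : ∀ z ∈ ball (0 : ℂ) 1, DifferentiableAt ℝ W z) (hz₁ : z₁ ∈ ball (0 : ℂ) 1)
    (h0 : W z₁ = 0) (hA : fderiv ℝ W z₁ 1 ≠ 0)
    (hB : ‖fderiv ℝ W z₁ Complex.I‖ = ‖fderiv ℝ W z₁ 1‖) (hδ : 0 < δ) (hδR : δ ≤ R)
    (hfin : IntegrableOn (energyDensity W) (sublevel W R)) :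
    ∃ ρ, 0 < ρ ∧ ρ ≤ δ ∧ ρ / 3 ≤ ∫ z in sublevel W ρ, energyDensity W z := by
  set A := fderiv ℝ W z₁ 1 with hAdef
  have hApos : 0 < ‖A‖ := norm_pos_iff.2 hA
  set e := Complex.equivRealProdCLM
  set p := e z₁ with hp
  set V : ℝ × ℝ → H := fun q ↦ W (e.symm q) with hVdef
  set V' : ℝ × ℝ → ℝ × ℝ →L[ℝ] H := fun q ↦
    (fderiv ℝ W (e.symm q)).comp (e.symm : ℝ × ℝ →L[ℝ] ℂ) with hV'def
  have hV (q) (hq : e.symm q ∈ ball (0 : ℂ) 1) : HasFDerivAt V (V' q) q :=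
    (hd _ hq).hasFDerivAt.comp q e.symm.hasFDerivAt
  have hep : e.symm p = z₁ := e.symm_apply_apply z₁
  have he10 : e.symm (1, 0) = 1 := by simp [e, Complex.equivRealProdCLM_symm_apply]
  have he01 : e.symm (0, 1) = Complex.I := by simp [e, Complex.equivRealProdCLM_symm_apply]
  have hev1 : ∀ᶠ q in 𝓝 p, e.symm q ∈ ball (0 : ℂ) 1 :=
    e.symm.continuous.continuousAt.eventually_mem (isOpen_ball.mem_nhds (by rwa [hep]))
  have hev2 := (hV p (by rwa [hep])).isLittleO.def (by positivity : 0 < ‖A‖ / 8)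
  obtain ⟨τ₀, hτ₀, hball⟩ := nhds_basis_closedBall.eventually_iff.1 (hev1.and hev2)
  obtain ⟨τ, hτ, hττ, hτδ⟩ : ∃ τ, 0 < τ ∧ τ ≤ τ₀ ∧ 9 * τ ^ 2 * ‖A‖ ^ 2 ≤ δ := by
    refine ⟨min τ₀ (√δ / (3 * ‖A‖)), lt_min hτ₀ (by positivity), min_le_left _ _, ?_⟩
    calc _ ≤ 9 * (√δ / (3 * ‖A‖)) ^ 2 * ‖A‖ ^ 2 := by
          gcongr
          exact min_le_right _ _
      _ = √δ ^ 2 := by field_simp; norm_num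
      _ = δ := Real.sq_sqrt hδ.le
  refine ⟨9 * τ ^ 2 * ‖A‖ ^ 2, by positivity, hτδ, ?_⟩
  have hQ (q) (hq : q ∈ closedBall p τ) := hball (closedBall_subset_closedBall hττ hq)
  have hV0 : V p = 0 := by rw [hVdef]; simp only [hep, h0]
  have hsub : e ⁻¹' closedBall p τ ⊆ sublevel W (9 * τ ^ 2 * ‖A‖ ^ 2) := by
    intro z hz
    obtain ⟨m1, m2⟩ := hQ _ hz
    rw [e.symm_apply_apply] at m1
    refine ⟨m1, ?_⟩
    set q := e z with hq
    have hqz : V q = W z := by rw [hVdef]; simp only [hq, e.symm_apply_apply]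
    have hqp : ‖q - p‖ ≤ τ := by rw [← dist_eq_norm]; exact hz
    rw [hqz, hV0, sub_zero] at m2
    have hlin : ‖V' p (q - p)‖ ≤ 2 * τ * ‖A‖ := by
      have hdec : q - p = (q - p).1 • ((1, 0) : ℝ × ℝ) + (q - p).2 • ((0, 1) : ℝ × ℝ) := by
        ext <;> simp
      rw [hdec, map_add, map_smul, map_smul]
      have e1 : V' p (1, 0) = A := by
        rw [hV'def]; simp only [ContinuousLinearMap.comp_apply, ContinuousLinearEquiv.coe_coe,
          he10, hep, hAdef]
      have e2 : ‖V' p (0, 1)‖ = ‖A‖ := by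
        rw [hV'def]; simp only [ContinuousLinearMap.comp_apply, ContinuousLinearEquiv.coe_coe,
          he01, hep, hAdef, hB]
      calc _ ≤ ‖(q - p).1‖ * ‖A‖ + ‖(q - p).2‖ * ‖A‖ := by
            refine (norm_add_le _ _).trans_eq ?_
            rw [norm_smul, norm_smul, e1, e2]
        _ ≤ τ * ‖A‖ + τ * ‖A‖ := by
            gcongr
            · exact (norm_fst_le _).trans hqp
            · exact (norm_snd_le _).trans hqp
        _ = _ := by ring
    have hWz : ‖W z‖ < 3 * τ * ‖A‖ := by
      have h3 : ‖W z‖ ≤ ‖W z - V' p (q - p)‖ + ‖V' p (q - p)‖ := by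
        simpa using norm_add_le (W z - V' p (q - p)) (V' p (q - p))
      have h4 : ‖A‖ / 8 * ‖q - p‖ ≤ ‖A‖ / 8 * τ := by gcongr
      have h5 : 0 < τ * ‖A‖ := by positivity
      linarith
    change ‖W z‖ ^ 2 < _
    calc _ < (3 * τ * ‖A‖) ^ 2 := by gcongr
      _ = _ := by ring
  have hmp := Complex.volume_preserving_equiv_real_prod
  have hemb := Complex.measurableEquivRealProd.measurableEmbedding
  have hfinρ : IntegrableOn (energyDensity W) (sublevel W (9 * τ ^ 2 * ‖A‖ ^ 2)) :=
    hfin.mono_set (sublevel_subset W (hτδ.trans hδR))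
  set E : ℝ × ℝ → ℝ := fun q ↦ energyDensity W (e.symm q) with hE
  have hEe : E ∘ Complex.measurableEquivRealProd = energyDensity W := by
    funext z
    exact congrArg (energyDensity W) (e.symm_apply_apply z)
  have hEint : IntegrableOn E (closedBall p τ) := by
    rw [← hmp.integrableOn_comp_preimage hemb, hEe]
    exact hfinρ.mono_set hsub
  have hEeq : ∫ z in e ⁻¹' closedBall p τ, energyDensity W z = ∫ q in closedBall p τ, E q := by
    rw [← hmp.setIntegral_preimage_emb hemb, ← hEe]
    rfl
  have hmono : ∫ z in e ⁻¹' closedBall p τ, energyDensity W z ≤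
      ∫ z in sublevel W (9 * τ ^ 2 * ‖A‖ ^ 2), energyDensity W z :=
    setIntegral_mono_set hfinρ (Eventually.of_forall fun z ↦ energyDensity_nonneg W z)
      hsub.eventuallyLE
  have hV'10 (q) : V' q (1, 0) = fderiv ℝ W (e.symm q) 1 := by
    rw [hV'def]
    simp only [ContinuousLinearMap.comp_apply, ContinuousLinearEquiv.coe_coe, he10]
  have hpt (q) : inner ℝ A (V' q (1, 0)) ≤ (‖A‖ ^ 2 + E q) / 2 ∧
      -((‖A‖ ^ 2 + E q) / 2) ≤ inner ℝ A (V' q (1, 0)) := by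
    have h1 := abs_le.1 (abs_real_inner_le_norm A (V' q (1, 0)))
    rw [hV'10] at h1 ⊢
    simp only [hE, energyDensity]
    constructor <;>
    nlinarith [sq_nonneg (‖A‖ - ‖fderiv ℝ W (e.symm q) 1‖),
      sq_nonneg ‖fderiv ℝ W (e.symm q) Complex.I‖]
  have hconst : IntegrableOn (fun _ ↦ ‖A‖ ^ 2) (closedBall p τ) :=
    integrableOn_const (isCompact_closedBall p τ).measure_lt_top.ne
  have hbd : IntegrableOn (fun q ↦ (‖A‖ ^ 2 + E q) / 2) (closedBall p τ) :=
    (hconst.add hEint).div_const 2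
  have hmeas : Measurable fun q ↦ inner ℝ A (V' q (1, 0)) := by
    borelize H
    simp_rw [hV'10]
    exact (innerSL ℝ A).continuous.measurable.comp
      ((measurable_fderiv_apply_const ℝ W 1).comp e.symm.continuous.measurable)
  have hvint : IntegrableOn (fun q ↦ inner ℝ A (V' q (1, 0))) (closedBall p τ) :=
    hbd.mono' hmeas.aestronglyMeasurable (Eventually.of_forall fun q ↦
      abs_le.2 ⟨(hpt q).2, (hpt q).1⟩)
  have hlow := integral_closedBall_fderiv_ge (v := fun q ↦ inner ℝ A (V q))
    (v' := fun q ↦ (innerSL ℝ A).comp (V' q)) (p := p) (η := ‖A‖ ^ 2 / 8) hτ.le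
    (fun q hq ↦ (innerSL ℝ A).hasFDerivAt.comp q (hV q (hQ q hq).1)) hvint (fun q hq ↦ by
      have h := (hQ q hq).2
      simp only [ContinuousLinearMap.comp_apply, innerSL_apply_apply, ← inner_sub_right]
      refine (abs_real_inner_le_norm _ _).trans ?_
      calc _ ≤ ‖A‖ * (‖A‖ / 8 * ‖q - p‖) := by gcongr
        _ = _ := by ring)
  have hup := setIntegral_mono hvint hbd fun q ↦ (hpt q).1
  have hvol : volume.real (closedBall p τ) = 4 * τ ^ 2 := by
    rw [closedBall_eq_Icc_prod, ← Icc_prod_Icc, Measure.volume_eq_prod, Measure.real,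
      Measure.prod_prod, Real.volume_Icc, Real.volume_Icc, ← ENNReal.ofReal_mul (by linarith),
      ENNReal.toReal_ofReal (by nlinarith)]
    ring
  rw [integral_div, integral_add hconst hEint, setIntegral_const, hvol, smul_eq_mul] at hup
  have hAp : inner ℝ A (V' p (1, 0)) = ‖A‖ ^ 2 := by
    rw [hV'10, hep, ← hAdef, real_inner_self_eq_norm_sq]
  simp only [ContinuousLinearMap.comp_apply, innerSL_apply_apply, hAp] at hlow
  rw [hEeq] at hmono
  linarith

end SmallSquare

section Disk
open Metric Set Filter Topology

/-- The linear bound for the energy of an almost `S`-holomorphic map with a nondegenerate zero. -/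
theorem energy_sublevel_ge {H : Type*} [NormedAddCommGroup H] [InnerProductSpace ℝ H]
    [FiniteDimensional ℝ H] {S : H →L[ℝ] H}
    (hS : ∀ x y, inner ℝ (S x) (S y) = inner ℝ x y) (hSS : ∀ x, S (S x) = -x) {W : ℂ → H}
    {β R R₁ : ℝ} (hβ0 : 0 < β) (hβ : β ≤ 1) (hR : 0 < R) (hR2 : R ≤ 1 / 2)
    (hRR : R < R₁) (hW : ContinuousOn W (closedBall 0 1))
    (hd : ∀ z ∈ ball (0 : ℂ) 1, DifferentiableAt ℝ W z)
    (hb : ∀ z : ℂ, ‖z‖ = 1 → R₁ < ‖W z‖ ^ 2)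
    (hξ : ∀ z ∈ ball (0 : ℂ) 1, ‖fderiv ℝ W z Complex.I - S (fderiv ℝ W z 1)‖ ≤
      β / 36 * (‖W z‖ ^ 2) ^ β * ‖fderiv ℝ W z 1‖)
    (hη : ∀ z ∈ ball (0 : ℂ) 1, ‖fderiv ℝ W z 1 + S (fderiv ℝ W z Complex.I)‖ ≤
      β / 36 * (‖W z‖ ^ 2) ^ β * ‖fderiv ℝ W z Complex.I‖)
    (hfin : IntegrableOn (energyDensity W) (sublevel W R₁)) {z₁ : ℂ}
    (hz₁ : z₁ ∈ ball (0 : ℂ) 1) (h0 : W z₁ = 0) (hA : fderiv ℝ W z₁ 1 ≠ 0) :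
    R / 384 ≤ ∫ z in sublevel W R, energyDensity W z := by
  have : CompleteSpace H := FiniteDimensional.complete ℝ H
  have hB : ‖fderiv ℝ W z₁ Complex.I‖ = ‖fderiv ℝ W z₁ 1‖ := by
    have h := hξ z₁ hz₁
    rw [h0, norm_zero, zero_pow two_ne_zero, Real.zero_rpow hβ0.ne', mul_zero, zero_mul,
      norm_le_zero_iff, sub_eq_zero] at h
    rw [h, ← sq_eq_sq₀ (norm_nonneg _) (norm_nonneg _), ← real_inner_self_eq_norm_sq, hS,
      real_inner_self_eq_norm_sq]
  obtain ⟨ρ, hρ, hρR, hlow⟩ := exists_le_energy_sublevel hd hz₁ h0 hA hB (half_pos hR)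
    (by linarith : R / 2 ≤ R₁) hfin
  have hup := energy_sublevel_le hS hSS hβ0 hβ hρ hρR (by linarith) hRR hW hd hb hξ hη hfin
  set I := ∫ z in sublevel W R, energyDensity W z
  have h := hlow.trans hup
  have h2 : R * (ρ / 3) ≤ R * (128 * ρ / R * I) := by gcongr
  have h3 : R * (128 * ρ / R * I) = ρ * (128 * I) := by field_simp
  have h4 : ρ * (R / 3) ≤ ρ * (128 * I) := by linarith
  have h5 := le_of_mul_le_mul_left h4 hρ
  linarith

/-- A path leaving a ball of radius `r` moves somewhere inside the ball of radius `r / 2`. -/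
theorem exists_deriv_ne_zero_of_norm_lt {F : Type*} [NormedAddCommGroup F] [NormedSpace ℝ F]
    {f f' : ℝ → F} {r : ℝ} (hr : 0 < r) (hf : ContinuousOn f (Icc 0 1))
    (hf' : ∀ t ∈ Ico (0 : ℝ) 1, HasDerivAt f (f' t) t) (h0 : f 0 = 0) (h1 : r ≤ ‖f 1‖) :
    ∃ t ∈ Ico (0 : ℝ) 1, ‖f t‖ < r / 2 ∧ f' t ≠ 0 := by
  by_contra! h
  have := image_norm_le_of_norm_deriv_right_lt_deriv_boundary hf
    (fun t ht ↦ (hf' t ht).hasDerivWithinAt) (B := fun t ↦ r / 4 * t) (B' := fun _ ↦ r / 4)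
    (by simp [h0]) (fun t ↦ by simpa using (hasDerivAt_id t).const_mul (r / 4))
    (fun t ht hB ↦ by
      rw [h t ht (by rw [hB]; nlinarith [ht.2]), norm_zero]
      positivity) (right_mem_Icc.2 zero_le_one)
  linarith

/-- The monotonicity lemma for an almost complex structure on a normed space `F` that embeds
linearly in a Euclidean space. -/
theorem ofReal_le_lintegral_energy {F E : Type*} [NormedAddCommGroup F] [NormedSpace ℝ F]
    [NormedAddCommGroup E] [InnerProductSpace ℝ E] [FiniteDimensional ℝ E]
    (ι : F →L[ℝ] E) (hι : ∀ v, ‖v‖ ≤ ‖ι v‖) {J : F → F →L[ℝ] F} {α K c : ℝ} (hα : α ∈ Ioo 0 1)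
    (hJ : ∀ x v, J x (J x v) = -v) (hJ2 : ∀ x, ‖J x‖ ≤ 2)
    (hK : ∀ x x', ‖J x - J x'‖ ≤ K * ‖x - x'‖ ^ α) (hc : 3 * ‖ι‖ ≤ c) (hc0 : 0 < c)
    (hcK : c * K ≤ α / 72) {r : ℝ} (hr : r ∈ Ioc 0 1) {x₀ : F} {u : ℂ → F}
    (hu : ContinuousOn u (closedBall 0 1))
    (hd : ∀ z ∈ ball (0 : ℂ) 1, DifferentiableAt ℝ u z)
    (hCR : ∀ z ∈ ball (0 : ℂ) 1, fderiv ℝ u z 1 + J (u z) (fderiv ℝ u z Complex.I) = 0)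
    (hu0 : u 0 = x₀) (hb : ∀ z : ℂ, ‖z‖ = 1 → r ≤ ‖u z - x₀‖) :
    ENNReal.ofReal (1 / (6144 * c ^ 2) * r ^ 2) ≤ ∫⁻ z in ball (0 : ℂ) 1 ∩ u ⁻¹' ball x₀ r,
      ENNReal.ofReal (‖fderiv ℝ u z 1‖ ^ 2 + ‖fderiv ℝ u z Complex.I‖ ^ 2) := by
  obtain ⟨hα0, hα1⟩ := hα
  obtain ⟨hr0, hr1⟩ := hr
  obtain ⟨t, ht, htr, hA⟩ := exists_deriv_ne_zero_of_norm_lt (f := fun t : ℝ ↦ u t - x₀)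
    (f' := fun t : ℝ ↦ fderiv ℝ u t 1) hr0
    ((hu.comp Complex.continuous_ofReal.continuousOn fun t ht ↦ by
      simp [abs_le]; constructor <;> linarith [ht.1, ht.2]).sub continuousOn_const)
    (fun t ht ↦ by
      have h1 : (t : ℂ) ∈ ball (0 : ℂ) 1 := by
        simp [abs_lt]; constructor <;> linarith [ht.1, ht.2]
      have := (hd _ h1).hasFDerivAt.comp_hasDerivAt t (Complex.ofRealCLM.hasDerivAt)
      exact (by simpa using this.sub_const x₀))
    (by simp [hu0]) (by simpa using hb 1 (by simp))
  set z₁ : ℂ := (t : ℂ)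
  have hz₁ : z₁ ∈ ball (0 : ℂ) 1 := by
    simp [z₁, abs_lt]; constructor <;> linarith [ht.1, ht.2]
  set p := u z₁
  let T₀ : F →L[ℝ] E × E := ι.prod (ι.comp (J p))
  let T : F →L[ℝ] WithLp 2 (E × E) :=
    ((WithLp.prodContinuousLinearEquiv 2 ℝ E E).symm : E × E →L[ℝ] WithLp 2 (E × E)).comp T₀
  let S : WithLp 2 (E × E) →L[ℝ] WithLp 2 (E × E) :=
    ((WithLp.prodContinuousLinearEquiv 2 ℝ E E).symm : E × E →L[ℝ] WithLp 2 (E × E)).comp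
      (((ContinuousLinearMap.snd ℝ E E).prod (-ContinuousLinearMap.fst ℝ E E)).comp
        (WithLp.prodContinuousLinearEquiv 2 ℝ E E : WithLp 2 (E × E) →L[ℝ] E × E))
  have hS (x y) : inner ℝ (S x) (S y) = inner ℝ x y := by
    rw [WithLp.prod_inner_apply, WithLp.prod_inner_apply]
    change inner ℝ x.snd y.snd + inner ℝ (-x.fst) (-y.fst) =
      inner ℝ x.fst y.fst + inner ℝ x.snd y.snd
    rw [inner_neg_neg, add_comm]
  have hSS (x) : S (S x) = -x := rfl
  have hST (v) : S (T v) = T (J p v) := by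
    change WithLp.toLp 2 (ι (J p v), -ι v) = WithLp.toLp 2 (ι (J p v), ι (J p (J p v)))
    rw [hJ, map_neg]
  have hTsq (v) : ‖T v‖ ^ 2 = ‖ι v‖ ^ 2 + ‖ι (J p v)‖ ^ 2 := WithLp.prod_norm_sq_eq_of_L2 _
  have hTlow (v) : ‖v‖ ≤ ‖T v‖ :=
    (hι v).trans
      (abs_le_of_sq_le_sq' (by rw [hTsq]; nlinarith [sq_nonneg ‖ι (J p v)‖]) (norm_nonneg _)).2
  have hTup (v) : ‖T v‖ ≤ c * ‖v‖ := by
    have h1 := ι.le_opNorm v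
    have h2 : ‖ι (J p v)‖ ≤ ‖ι‖ * (2 * ‖v‖) :=
      (ι.le_opNorm _).trans (by gcongr; exact (J p).le_of_opNorm_le (hJ2 p) v)
    have h3 : ‖T v‖ ≤ ‖ι v‖ + ‖ι (J p v)‖ := by
      refine (abs_le_of_sq_le_sq' ?_ (by positivity)).2
      rw [hTsq]
      nlinarith [norm_nonneg (ι v), norm_nonneg (ι (J p v))]
    nlinarith [norm_nonneg v]
  set W : ℂ → WithLp 2 (E × E) := fun z ↦ T (u z - p) with hWdef
  have hWd (z) (hz : z ∈ ball (0 : ℂ) 1) : HasFDerivAt W (T.comp (fderiv ℝ u z)) z :=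
    T.hasFDerivAt.comp z ((hd z hz).hasFDerivAt.sub_const p)
  have hWv (z) (hz : z ∈ ball (0 : ℂ) 1) (v : ℂ) : fderiv ℝ W z v = T (fderiv ℝ u z v) := by
    rw [(hWd z hz).fderiv]; rfl
  have hJdiff (z) (v : F) : ‖T (J (u z) v - J p v)‖ ≤
      α / 2 / 36 * (‖W z‖ ^ 2) ^ (α / 2) * ‖T v‖ := by
    have h1 : ‖J (u z) v - J p v‖ ≤ K * ‖u z - p‖ ^ α * ‖v‖ :=
      ((J (u z) - J p).le_opNorm v).trans (by gcongr; exact hK _ _)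
    have h2 : (‖W z‖ ^ 2) ^ (α / 2) = ‖W z‖ ^ α := by
      rw [← Real.rpow_natCast, ← Real.rpow_mul (norm_nonneg _)]
      congr 1
      push_cast
      ring
    have h3 : ‖u z - p‖ ^ α ≤ ‖W z‖ ^ α := Real.rpow_le_rpow (norm_nonneg _) (hTlow _) hα0.le
    rw [h2]
    calc _ ≤ c * ‖J (u z) v - J p v‖ := hTup _
      _ ≤ c * (K * ‖u z - p‖ ^ α * ‖v‖) := by gcongr
      _ = c * K * (‖u z - p‖ ^ α * ‖v‖) := by ring
      _ ≤ α / 72 * (‖W z‖ ^ α * ‖T v‖) := by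
        gcongr
        exact hTlow v
      _ = _ := by ring
  have hξ : ∀ z ∈ ball (0 : ℂ) 1, ‖fderiv ℝ W z Complex.I - S (fderiv ℝ W z 1)‖ ≤
      α / 2 / 36 * (‖W z‖ ^ 2) ^ (α / 2) * ‖fderiv ℝ W z 1‖ := fun z hz ↦ by
    have h : J (u z) (fderiv ℝ u z 1) = fderiv ℝ u z Complex.I := by
      rw [eq_neg_of_add_eq_zero_left (hCR z hz), map_neg, hJ, neg_neg]
    rw [hWv z hz, hWv z hz, hST, ← map_sub, ← h]
    exact hJdiff z _
  have hη : ∀ z ∈ ball (0 : ℂ) 1, ‖fderiv ℝ W z 1 + S (fderiv ℝ W z Complex.I)‖ ≤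
      α / 2 / 36 * (‖W z‖ ^ 2) ^ (α / 2) * ‖fderiv ℝ W z Complex.I‖ := fun z hz ↦ by
    rw [hWv z hz, hWv z hz, hST, ← map_add, eq_neg_of_add_eq_zero_left (hCR z hz), ← norm_neg,
      ← map_neg, neg_add, neg_neg, ← sub_eq_add_neg]
    exact hJdiff z _
  have hWc : ContinuousOn W (closedBall 0 1) :=
    T.continuous.comp_continuousOn (hu.sub continuousOn_const)
  have hbW : ∀ z : ℂ, ‖z‖ = 1 → r ^ 2 / 8 < ‖W z‖ ^ 2 := fun z hz ↦ by
    have h1 : ‖u z - x₀‖ ≤ ‖u z - p‖ + ‖p - x₀‖ := by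
      simpa using norm_add_le (u z - p) (p - x₀)
    have h2 : r / 2 ≤ ‖W z‖ := (by linarith [hb z hz] : r / 2 ≤ ‖u z - p‖).trans (hTlow _)
    nlinarith
  have hsub : sublevel W (r ^ 2 / 8) ⊆ ball (0 : ℂ) 1 ∩ u ⁻¹' ball x₀ r := by
    rintro z ⟨hz, hz2⟩
    refine ⟨hz, ?_⟩
    change ‖W z‖ ^ 2 < _ at hz2
    have h2 : ‖W z‖ < r / 2 := by
      by_contra! h
      nlinarith
    have h1 : ‖u z - x₀‖ ≤ ‖u z - p‖ + ‖p - x₀‖ := by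
      simpa using norm_add_le (u z - p) (p - x₀)
    rw [mem_preimage, mem_ball, dist_eq_norm]
    have h3 : ‖u z - p‖ ≤ ‖W z‖ := hTlow _
    linarith
  have hmR := (isOpen_sublevel (hWc.mono ball_subset_closedBall) (r ^ 2 / 8)).measurableSet
  set Q := ∫⁻ z in ball (0 : ℂ) 1 ∩ u ⁻¹' ball x₀ r,
      ENNReal.ofReal (‖fderiv ℝ u z 1‖ ^ 2 + ‖fderiv ℝ u z Complex.I‖ ^ 2) with hQ
  have hle : ∫⁻ z in sublevel W (r ^ 2 / 8), ENNReal.ofReal (energyDensity W z) ≤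
      ENNReal.ofReal (c ^ 2) * Q := by
    rw [hQ, ← lintegral_const_mul' _ _ ENNReal.ofReal_ne_top]
    refine (setLIntegral_mono' hmR fun z hz ↦ ?_).trans (lintegral_mono_set hsub)
    rw [← ENNReal.ofReal_mul (by positivity)]
    refine ENNReal.ofReal_le_ofReal ?_
    rw [energyDensity, hWv z hz.1, hWv z hz.1, mul_add, ← mul_pow, ← mul_pow]
    gcongr <;> exact hTup _
  by_cases hQtop : Q = ⊤
  · rw [hQtop]; exact le_top
  have hfin : IntegrableOn (energyDensity W) (sublevel W (r ^ 2 / 8)) := by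
    have : CompleteSpace (WithLp 2 (E × E)) := FiniteDimensional.complete ℝ _
    rw [IntegrableOn, ← lintegral_ofReal_ne_top_iff_integrable
      (measurable_energyDensity W).aestronglyMeasurable
      (Eventually.of_forall (energyDensity_nonneg W))]
    exact (hle.trans_lt (ENNReal.mul_lt_top ENNReal.ofReal_lt_top
      (lt_top_iff_ne_top.2 hQtop))).ne
  have hrr : r ^ 2 ≤ 1 := by nlinarith
  have hmain := energy_sublevel_ge hS hSS (by positivity : 0 < α / 2) (by linarith)
    (by positivity : 0 < r ^ 2 / 16) (by linarith) (by nlinarith) hWc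
    (fun z hz ↦ (hWd z hz).differentiableAt) hbW hξ hη hfin hz₁
    (by simp [hWdef, p]) (by
      rw [hWv _ hz₁]
      exact fun h ↦ hA (norm_le_zero_iff.1 ((hTlow _).trans_eq (by rw [h, norm_zero]))))
  have hsubR : sublevel W (r ^ 2 / 16) ⊆ sublevel W (r ^ 2 / 8) :=
    sublevel_subset W (by linarith [sq_nonneg r])
  have hfinal : ENNReal.ofReal (r ^ 2 / 16 / 384) ≤ ENNReal.ofReal (c ^ 2) * Q := by
    refine (ENNReal.ofReal_le_ofReal hmain).trans ?_
    rw [ofReal_integral_eq_lintegral_ofReal (hfin.mono_set hsubR)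
      (Eventually.of_forall (energyDensity_nonneg W))]
    exact (lintegral_mono_set hsubR).trans hle
  have heq : 1 / (6144 * c ^ 2) * r ^ 2 = r ^ 2 / 16 / 384 / c ^ 2 := by
    field_simp; norm_num
  rw [heq, ENNReal.ofReal_div_of_pos (by positivity)]
  exact ENNReal.div_le_of_le_mul' hfinal

end Disk

/-- local chart version of the monotonicity lemma (Lemma 2.6
part 1): a pseudoholomorphic disk passing through the center of a ball of
radius `r` and reaching its boundary has energy at least `C_M r²` inside the
ball.  The `C^α` closeness of `J` to `J_st` is encoded by a sup bound `MJ` and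
a Hölder constant `HJ` with `MJ + HJ < ε`. -/
theorem monotonicity_lemma (n : ℕ) (hn : 1 ≤ n)
    (α : ℝ) (hα : α ∈ Set.Ioo (0 : ℝ) 1) :
    ∃ ε > 0, ∃ CM > 0,
      ∀ (J : (Fin n → ℂ) → ((Fin n → ℂ) →L[ℝ] (Fin n → ℂ))) (MJ HJ : ℝ),
        (∀ x, ‖J x - Jstd n‖ ≤ MJ) →
        (∀ x x', ‖J x - J x'‖ ≤ HJ * ‖x - x'‖ ^ α) →
        MJ + HJ < ε →
        (∀ x v, J x (J x v) = -v) →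
        ∀ (r : ℝ), r ∈ Set.Ioc (0 : ℝ) 1 →
        ∀ (x₀ : Fin n → ℂ) (u : ℂ → (Fin n → ℂ)),
          ContinuousOn u (Metric.closedBall (0 : ℂ) 1) →
          (∀ z ∈ Metric.ball (0 : ℂ) 1, DifferentiableAt ℝ u z) →
          (∀ z ∈ Metric.ball (0 : ℂ) 1,
            fderiv ℝ u z 1 + J (u z) (fderiv ℝ u z Complex.I) = 0) →
          u 0 = x₀ →
          (∀ z : ℂ, ‖z‖ = 1 → r ≤ ‖u z - x₀‖) →
          ENNReal.ofReal (CM * r ^ 2) ≤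
            ∫⁻ z in Metric.ball (0 : ℂ) 1 ∩ u ⁻¹' (Metric.ball x₀ r),
              ENNReal.ofReal
                (‖fderiv ℝ u z 1‖ ^ 2 + ‖fderiv ℝ u z Complex.I‖ ^ 2) := by
  obtain ⟨hα0, hα1⟩ := hα
  have : Nonempty (Fin n) := ⟨⟨0, hn⟩⟩
  set ι : (Fin n → ℂ) →L[ℝ] PiLp 2 fun _ : Fin n ↦ ℂ :=
    ((PiLp.continuousLinearEquiv 2 ℝ fun _ : Fin n ↦ ℂ).symm :
      (Fin n → ℂ) →L[ℝ] PiLp 2 fun _ : Fin n ↦ ℂ)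
  have hι (v : Fin n → ℂ) : ‖v‖ ≤ ‖ι v‖ :=
    (pi_norm_le_iff_of_nonneg (norm_nonneg _)).2 fun i ↦ PiLp.norm_apply_le (ι v) i
  set c := 3 * ‖ι‖ + 1 with hc
  have hc0 : 0 < c := by positivity
  refine ⟨min 1 (α / 72 / c), by positivity, 1 / (6144 * c ^ 2), by positivity, ?_⟩
  intro J MJ HJ hM hH hMH hJ r hr x₀ u hu hd hCR hu0 hb
  have hM0 : 0 ≤ MJ := (norm_nonneg _).trans (hM 0)
  have hH0 : 0 ≤ HJ := by
    have h := (norm_nonneg _).trans (hH 1 0)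
    rwa [sub_zero, norm_one, Real.one_rpow, mul_one] at h
  have hε1 : MJ ≤ 1 := by linarith [min_le_left 1 (α / 72 / c)]
  have hε2 : HJ ≤ α / 72 / c := by linarith [min_le_right 1 (α / 72 / c)]
  have hJ2 (x) : ‖J x‖ ≤ 2 := by
    have h1 : ‖Jstd n‖ ≤ 1 := by
      refine ContinuousLinearMap.opNorm_le_bound _ zero_le_one fun v ↦ ?_
      simp [Jstd, norm_smul]
    have h2 : ‖J x‖ ≤ ‖J x - Jstd n‖ + ‖Jstd n‖ := by
      simpa using norm_add_le (J x - Jstd n) (Jstd n)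
    linarith [hM x]
  exact ofReal_le_lintegral_energy ι hι ⟨hα0, hα1⟩ hJ hJ2 hH (by linarith) hc0
    (by rw [mul_comm]; exact (le_div_iff₀ hc0).1 hε2) hr hu hd hCR hu0 hb
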